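/- arXiv:2511.22824 — 2 statements merged into one kernel-verified Lean document; each statement's English description precedes it below -/
import Mathlib

section
/- Let α* = (75 − 3√145)/40 and define g(α) = 1 − (18 − 17α)(3 − 2α)/(54(2 − α)). Then g(α*) = α*, and for every α with α* < α ≤ 1 one has α* ≤ g(α) < α. -/
/-- Let α* = (75 − 3√145)/40 and g(α) = 1 − (18 − 17α)(3 − 2α)/(54(2 − α)).
Then g(α*) = α*, and for every α with α* < α ≤ 1 one has α* ≤ g(α) < α. -/
theorem statement_14 :
    (1 - (18 - 17 * ((75 - 3 * Real.sqrt 145) / 40)) * (3 - 2 * ((75 - 3 * Real.sqrt 145) / 40)) /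
        (54 * (2 - (75 - 3 * Real.sqrt 145) / 40)) = (75 - 3 * Real.sqrt 145) / 40) ∧
    ∀ α : ℝ, (75 - 3 * Real.sqrt 145) / 40 < α → α ≤ 1 →
      (75 - 3 * Real.sqrt 145) / 40 ≤ 1 - (18 - 17 * α) * (3 - 2 * α) / (54 * (2 - α)) ∧
      1 - (18 - 17 * α) * (3 - 2 * α) / (54 * (2 - α)) < α := by
  have hs : Real.sqrt 145 ^ 2 = 145 := Real.sq_sqrt (by norm_num)
  have hs12 : 12 < Real.sqrt 145 := Real.lt_sqrt_of_sq_lt (by norm_num)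
  have hs13 : Real.sqrt 145 < 13 := (Real.sqrt_lt' (by norm_num)).2 (by norm_num)
  obtain ⟨a, ha⟩ : ∃ a, a = (75 - 3 * Real.sqrt 145) / 40 := ⟨_, rfl⟩
  rw [← ha]
  have hroot : 20 * a ^ 2 - 75 * a + 54 = 0 := by
    rw [ha]
    linear_combination (9 / 80) * hs
  have ha0 : 9 / 10 < a := by linarith
  have ha1 : a < 1 := by linarith
  clear ha hs hs12 hs13
  refine ⟨?_, fun α hα hα1 => ?_⟩
  · have h2 : 2 - a ≠ 0 := by linarith
    field_simp
    linear_combination hroot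
  · have hd : 0 < 54 * (2 - α) := by linarith
    constructor
    · rw [le_sub_comm, div_le_iff₀ hd]
      have hfactor : 0 ≤ (α - a) * (33 + 20 * a - 34 * α) :=
        mul_nonneg (by linarith) (by linarith)
      linear_combination hfactor - hroot
    · rw [sub_lt_comm, lt_div_iff₀ hd]
      have hfactor : 0 < (α - a) * (75 - 20 * α - 20 * a) :=
        mul_pos (by linarith) (by linarith)
      linear_combination hfactor + hroot
end

section
/- Define the sequence (α_k) by α₁ = 1 and α_{k+1} = 1 − (18 − 17α_k)(3 − 2α_k)/(54(2 − α_k)), and let α* = (75 − 3√145)/40. Then for every k one has α* ≤ α_{k+1} ≤ α_k ≤ 1, and α_k converges to α* as k → ∞. -/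
/-- If `s` is a root of `20 s² - 75 s + 54`, one step of the iteration maps `[s, 1]` into itself,
is nonincreasing, and at least halves the distance to `s`. -/
lemma iteration_step {s x : ℝ} (hs : 20 * s ^ 2 - 75 * s + 54 = 0) (hs0 : 1 / 2 ≤ s)
    (hs1 : s ≤ 1) (hsx : s ≤ x) (hx : x ≤ 1) :
    s ≤ 1 - (18 - 17 * x) * (3 - 2 * x) / (54 * (2 - x)) ∧
    1 - (18 - 17 * x) * (3 - 2 * x) / (54 * (2 - x)) ≤ x ∧
    1 - (18 - 17 * x) * (3 - 2 * x) / (54 * (2 - x)) - s ≤ (x - s) / 2 := by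
  have hd : 0 < 54 * (2 - x) := by linarith
  refine ⟨?_, ?_, ?_⟩
  · have : (18 - 17 * x) * (3 - 2 * x) / (54 * (2 - x)) ≤ 1 - s := by
      rw [div_le_iff₀ hd]
      have : 0 ≤ (x - s) * (33 + 20 * s - 34 * x) :=
        mul_nonneg (by linarith) (by linarith)
      linarith
    linarith
  · have : 1 - x ≤ (18 - 17 * x) * (3 - 2 * x) / (54 * (2 - x)) := by
      rw [le_div_iff₀ hd]
      have : 0 ≤ (x - s) * (75 - 20 * s - 20 * x) :=
        mul_nonneg (by linarith) (by linarith)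
      linarith
    linarith
  · have : 1 - s - (x - s) / 2 ≤ (18 - 17 * x) * (3 - 2 * x) / (54 * (2 - x)) := by
      rw [le_div_iff₀ hd]
      have : 0 ≤ (x - s) * (21 + 7 * x - 20 * s) :=
        mul_nonneg (by linarith) (by linarith)
      linarith
    linarith


/-- The sequence α₁ = 1, α_{k+1} = 1 − (18 − 17α_k)(3 − 2α_k)/(54(2 − α_k))
satisfies α* ≤ α_{k+1} ≤ α_k ≤ 1 for every k ≥ 1 and converges to α* = (75 − 3√145)/40. -/
theorem statement_18 (a : ℕ → ℝ) (h1 : a 1 = 1)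
    (hrec : ∀ k, 1 ≤ k → a (k + 1) = 1 - (18 - 17 * a k) * (3 - 2 * a k) / (54 * (2 - a k))) :
    (∀ k, 1 ≤ k →
      (75 - 3 * Real.sqrt 145) / 40 ≤ a (k + 1) ∧ a (k + 1) ≤ a k ∧ a k ≤ 1) ∧
    Filter.Tendsto a Filter.atTop (nhds ((75 - 3 * Real.sqrt 145) / 40)) := by
  have hsq : Real.sqrt 145 ^ 2 = 145 := Real.sq_sqrt (by norm_num)
  have hlo : 12 ≤ Real.sqrt 145 := Real.le_sqrt_of_sq_le (by norm_num)
  have hhi : Real.sqrt 145 ≤ 13 := Real.sqrt_le_iff.mpr (by norm_num)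
  generalize hs : (75 - 3 * Real.sqrt 145) / 40 = s
  have hroot : 20 * s ^ 2 - 75 * s + 54 = 0 := by
    rw [← hs]
    linarith
  have hs0 : 1 / 2 ≤ s := by linarith
  have hs1 : s ≤ 1 := by linarith
  have bounds : ∀ n, s ≤ a (n + 1) ∧ a (n + 1) ≤ 1 ∧ a (n + 1) - s ≤ (1 / 2) ^ n := by
    intro n
    induction n with
    | zero => norm_num [h1]; constructor <;> linarith
    | succ n ih =>
      obtain ⟨hl, hu, hp⟩ := ih
      obtain ⟨h₁, h₂, h₃⟩ := iteration_step hroot hs0 hs1 hl hu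
      rw [← hrec (n + 1) (by omega)] at h₁ h₂ h₃
      refine ⟨h₁, h₂.trans hu, ?_⟩
      rw [pow_succ]
      linarith
  constructor
  · intro k hk
    obtain ⟨n, rfl⟩ := Nat.exists_eq_add_of_le' hk
    obtain ⟨hl, hu, -⟩ := bounds n
    obtain ⟨h₁, h₂, -⟩ := iteration_step hroot hs0 hs1 hl hu
    rw [← hrec (n + 1) hk] at h₁ h₂
    exact ⟨h₁, h₂, hu⟩
  · rw [← Filter.tendsto_add_atTop_iff_nat 1]
    have hpow : Filter.Tendsto (fun n : ℕ => s + (1 / 2 : ℝ) ^ n) Filter.atTop (nhds s) := by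
      simpa using (tendsto_pow_atTop_nhds_zero_of_lt_one (r := (1 / 2 : ℝ))
        (by norm_num) (by norm_num)).const_add s
    exact tendsto_of_tendsto_of_tendsto_of_le_of_le tendsto_const_nhds hpow
      (fun n => (bounds n).1) (fun n => by linarith [(bounds n).2.2])
end
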